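/- Let F = ℚ(q,α,β,z,w) be the field of rational functions over ℚ in the indeterminates q, α, β, z, w. For n ∈ ℕ and 0 ≤ i, j ≤ n define 𝖱ⁿ_{ij}(α,β|z) := β^{−i} · (q;q)_n (α/z;q)_{n−j} (1/β;q)_{n−i} (β/z;q)_i / ((q;q)_i (q;q)_{n−i} (1/z;q)_n (1/β;q)_{n−j}) · Σ_{s=0}^{min(i, n−j)} (q^{−i};q)_s (q^{−n+j};q)_s (z/(αβ);q)_s (q^{−n+1}z;q)_s q^{s} / ((q;q)_s (q^{−n};q)_s (q^{−i+1}z/β;q)_s (q^{−n+j+1}z/α;q)_s). Then for all 0 ≤ i, j ≤ n: Σ_{k=0}^{n} 𝖱ⁿ_{ik}(α,β|z) · w^{k} · 𝖱ⁿ_{kj}(α,β|w) · z^{j} = Σ_{k=0}^{n} 𝖱ⁿ_{ik}(α,β|w) · z^{k} · 𝖱ⁿ_{kj}(α,β|z) · w^{j}, where 𝖱ⁿ_{ij}(α,β|w) denotes the same expression with z replaced by w. -/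

import Mathlib

open Finset

/-- The `q`-shifted factorial `(a;q)_n = ∏_{i=0}^{n-1} (1 - a q^i)`. -/
noncomputable def qPoch {F : Type*} [Field F] (q a : F) (n : ℕ) : F :=
  ∏ i ∈ Finset.range n, (1 - a * q ^ i)

/-- The `₄φ₃`-type matrix entry `𝖱ⁿ_{ij}(α,β|ζ)` of Proposition D.5. -/
noncomputable def RHG {F : Type*} [Field F] (q α β ζ : F) (n i j : ℕ) : F :=
  β ^ (-(i : ℤ)) *
    (qPoch q q n * qPoch q (α / ζ) (n - j) * qPoch q (1 / β) (n - i) * qPoch q (β / ζ) i /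
      (qPoch q q i * qPoch q q (n - i) * qPoch q (1 / ζ) n * qPoch q (1 / β) (n - j))) *
    ∑ s ∈ Finset.range (min i (n - j) + 1),
      qPoch q (q ^ (-(i : ℤ))) s * qPoch q (q ^ ((j : ℤ) - (n : ℤ))) s *
          qPoch q (ζ / (α * β)) s * qPoch q (q ^ (1 - (n : ℤ)) * ζ) s * q ^ s /
        (qPoch q q s * qPoch q (q ^ (-(n : ℤ))) s *
          qPoch q (q ^ (1 - (i : ℤ)) * ζ / β) s *
          qPoch q (q ^ ((j : ℤ) - (n : ℤ) + 1) * ζ / α) s)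

/-- The field `F = ℚ(q,α,β,z,w)` of rational functions over `ℚ` in five indeterminates. -/
noncomputable abbrev F6 : Type := FractionRing (MvPolynomial (Fin 5) ℚ)
section Cyclic

variable {F : Type*} [Field F]

open Polynomial Matrix in
lemma Matrix.commute_of_cyclic {ι : Type*} [Fintype ι] [DecidableEq ι] {H M M' : Matrix ι ι F}
    (v : ι → F) (hv : ∀ x : ι → F, ∃ p : F[X], aeval H p *ᵥ v = x)
    (hM : Commute M H) (hM' : Commute M' H) : Commute M M' := by
  have main : ∀ N : Matrix ι ι F, Commute N H → ∃ p : F[X], N = aeval H p := by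
    intro N hN
    have hc : ∀ r : F[X], Commute N (aeval H r) := fun r =>
      Algebra.commute_of_mem_adjoin_singleton_of_commute (aeval_mem_adjoin_singleton F H) hN
    obtain ⟨p, hp⟩ := hv (N *ᵥ v)
    refine ⟨p, Matrix.toLin'.injective (LinearMap.ext fun x => ?_)⟩
    obtain ⟨r, rfl⟩ := hv x
    simp only [Matrix.toLin'_apply, Matrix.mulVec_mulVec]
    rw [(hc r).eq, ← Matrix.mulVec_mulVec, ← hp, Matrix.mulVec_mulVec, ← map_mul, ← map_mul,
      mul_comm]
  obtain ⟨p, rfl⟩ := main M hM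
  obtain ⟨r, rfl⟩ := main M' hM'
  exact (Commute.all p r).map (aeval H)

open Polynomial Matrix in
/-- The first basis vector is cyclic for an unreduced Hessenberg matrix. -/
lemma Matrix.exists_aeval_mulVec_of_hessenberg {n : ℕ} (H : Matrix (Fin (n + 1)) (Fin (n + 1)) F)
    (h0 : ∀ i j : Fin (n + 1), (j : ℕ) + 1 < i → H i j = 0)
    (h1 : ∀ i j : Fin (n + 1), (j : ℕ) + 1 = i → H i j ≠ 0) (x : Fin (n + 1) → F) :
    ∃ p : F[X], aeval H p *ᵥ Pi.single 0 1 = x := by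
  let W : Submodule F (Fin (n + 1) → F) := LinearMap.range
    ((LinearMap.applyₗ (Pi.single 0 1 : Fin (n + 1) → F)) ∘ₗ
      (Matrix.toLin' : Matrix (Fin (n + 1)) (Fin (n + 1)) F ≃ₗ[F] _).toLinearMap ∘ₗ
      (aeval H).toLinearMap)
  have memW : ∀ y, y ∈ W ↔ ∃ p : F[X], aeval H p *ᵥ Pi.single 0 1 = y := by
    intro y; simp [W, LinearMap.mem_range]
  have HW : ∀ y ∈ W, H *ᵥ y ∈ W := by
    intro y hy
    obtain ⟨p, rfl⟩ := (memW y).mp hy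
    exact (memW _).mpr ⟨X * p, by rw [map_mul, aeval_X, Matrix.mulVec_mulVec]⟩
  have basis : ∀ k : ℕ, ∀ i : Fin (n + 1), (i : ℕ) ≤ k → (Pi.single i 1 : Fin (n + 1) → F) ∈ W := by
    intro k
    induction k with
    | zero =>
      intro i hi
      obtain rfl : i = 0 := by ext; simpa using hi
      exact (memW _).mpr ⟨1, by rw [map_one, Matrix.one_mulVec]⟩
    | succ k ih =>
      intro i hi
      rcases Nat.lt_or_ge (i : ℕ) (k + 1) with hlt | hge
      · exact ih i (by lia)
      let j : Fin (n + 1) := ⟨k, by lia⟩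
      have hij : (j : ℕ) + 1 = i := by simp [j]; lia
      have hsum : H *ᵥ Pi.single j 1 = ∑ l, H l j • (Pi.single l 1 : Fin (n + 1) → F) := by
        ext l
        simp [Finset.sum_apply, Pi.single_apply]
      rw [← Finset.add_sum_erase _ _ (Finset.mem_univ i)] at hsum
      have hrest : ∑ l ∈ univ.erase i, H l j • (Pi.single l 1 : Fin (n + 1) → F) ∈ W := by
        refine Submodule.sum_mem _ fun l hl => ?_
        have hne : (l : ℕ) ≠ i := fun h => Finset.ne_of_mem_erase hl (Fin.ext h)
        by_cases hlk : (l : ℕ) ≤ k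
        · exact W.smul_mem _ (ih l hlk)
        · rw [h0 l j (by simp only [j]; lia), zero_smul]
          exact W.zero_mem
      have hmem : H i j • (Pi.single i 1 : Fin (n + 1) → F) ∈ W := by
        rw [eq_sub_of_add_eq hsum.symm]
        exact W.sub_mem (HW _ (ih j le_rfl)) hrest
      exact (W.smul_mem_iff (h1 i j hij)).mp hmem
  rw [← memW, pi_eq_sum_univ' x]
  refine Submodule.sum_mem _ fun l _ => W.smul_mem _ ?_
  convert basis l l le_rfl using 1

end Cyclic


/-- Genericity of the parameters: no monomial occurring in a denominator is a power of `q`. -/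
structure QGeneric {F : Type*} [Field F] (q α β z : F) : Prop where
  q_ne : q ≠ 0
  α_ne : α ≠ 0
  β_ne : β ≠ 0
  z_ne : z ≠ 0
  pow_ne : ∀ k : ℕ, q ^ (k + 1) ≠ 1
  zpow_ne_α : ∀ m : ℤ, q ^ m ≠ α
  zpow_mul_β : ∀ m : ℤ, q ^ m * β ≠ 1
  zpow_ne_z : ∀ m : ℤ, q ^ m ≠ z
  zpow_mul_α_ne_z : ∀ m : ℤ, q ^ m * α ≠ z
  zpow_mul_β_ne_z : ∀ m : ℤ, q ^ m * β ≠ z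

/-- The coefficients `(a;q)_m / (q;q)_m` of the `q`-binomial series, extended by zero to `m < 0`. -/
noncomputable def qBinomCoeff {F : Type*} [Field F] (q a : F) (m : ℤ) : F :=
  if m < 0 then 0 else qPoch q a m.toNat / qPoch q q m.toNat

/-- The diagonal factor in the Gauss decomposition of `RHG`. -/
noncomputable def gaussDiag {F : Type*} [Field F] (q α β z : F) (n s : ℕ) : F :=
  qPoch q (z / (α * β)) s * (α * β / z) ^ s * qPoch q q (n - s) /
    (qPoch q q s * qPoch q (1 / z) (n - s))

/-- `RHG` with row index `i` and column index `n - m`, up to a diagonal change of basis. -/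
noncomputable def gaussEntry {F : Type*} [Field F] (q α β z : F) (n : ℕ) (i m : ℤ) : F :=
  ∑ s ∈ range (n + 1),
    gaussDiag q α β z n s * qBinomCoeff q (β / z) (i - s) * qBinomCoeff q (α / z) (m - s)

section QSeries

variable {F : Type*} [Field F] {q α β z w a : F}

lemma qPoch_zero : qPoch q a 0 = 1 := by simp [qPoch]

lemma qPoch_succ (n : ℕ) : qPoch q a (n + 1) = qPoch q a n * (1 - a * q ^ n) := by
  simp [qPoch, prod_range_succ]

lemma qPoch_ne_zero (h : ∀ k : ℕ, 1 - a * q ^ k ≠ 0) (n : ℕ) : qPoch q a n ≠ 0 :=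
  prod_ne_zero_iff.mpr fun k _ => h k

lemma qPoch_self_ne_zero (h : ∀ k : ℕ, q ^ (k + 1) ≠ 1) (n : ℕ) : qPoch q q n ≠ 0 :=
  qPoch_ne_zero (fun k => by rw [← pow_succ']; exact sub_ne_zero.mpr (h k).symm) n

lemma qBinomCoeff_of_neg {m : ℤ} (hm : m < 0) : qBinomCoeff q a m = 0 := by
  simp [qBinomCoeff, hm]

lemma qBinomCoeff_natCast (m : ℕ) : qBinomCoeff q a m = qPoch q a m / qPoch q q m := by
  simp [qBinomCoeff]

lemma qBinomCoeff_sub_one (hq : ∀ k : ℕ, q ^ (k + 1) ≠ 1)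
    (ha : ∀ m : ℤ, 1 - a * q ^ m ≠ 0) (m : ℤ) :
    qBinomCoeff q a (m - 1) = qBinomCoeff q a m * (1 - q ^ m) / (1 - a * q ^ (m - 1)) := by
  rcases lt_trichotomy m 0 with hm | rfl | hm
  · rw [qBinomCoeff_of_neg hm, qBinomCoeff_of_neg (by lia)]; simp
  · rw [qBinomCoeff_of_neg (by lia)]; simp
  · obtain ⟨k, rfl⟩ : ∃ k : ℕ, m = (k + 1 : ℕ) := ⟨(m - 1).toNat, by lia⟩
    have hk : ((k + 1 : ℕ) : ℤ) - 1 = k := by lia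
    have h1 := ha k
    have h2 := qPoch_self_ne_zero hq k
    have h3 : 1 - q ^ k * q ≠ 0 := by rw [← pow_succ]; exact sub_ne_zero.mpr (hq k).symm
    rw [hk, qBinomCoeff_natCast, qBinomCoeff_natCast, qPoch_succ, qPoch_succ, zpow_natCast,
      zpow_natCast, pow_succ'] at *
    field_simp

namespace QGeneric

lemma one_sub_β_div_z_ne (h : QGeneric q α β z) (m : ℤ) : 1 - β / z * q ^ m ≠ 0 := by
  have hz := h.z_ne
  intro h0
  apply h.zpow_mul_β_ne_z m
  field_simp at h0
  linear_combination -h0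

lemma one_sub_α_div_z_ne (h : QGeneric q α β z) (m : ℤ) : 1 - α / z * q ^ m ≠ 0 := by
  have hz := h.z_ne
  intro h0
  apply h.zpow_mul_α_ne_z m
  field_simp at h0
  linear_combination -h0

lemma one_sub_inv_z_ne (h : QGeneric q α β z) (m : ℤ) : 1 - 1 / z * q ^ m ≠ 0 := by
  have hz := h.z_ne
  intro h0
  apply h.zpow_ne_z m
  field_simp at h0
  linear_combination -h0

lemma zpow_ne_β (h : QGeneric q α β z) (m : ℤ) : q ^ m ≠ β := by
  intro h0
  apply h.zpow_mul_β (-m)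
  rw [← h0, ← zpow_add₀ h.q_ne]; simp

lemma one_sub_inv_β_ne (h : QGeneric q α β z) (m : ℤ) : 1 - 1 / β * q ^ m ≠ 0 := by
  have hz := h.β_ne
  intro h0
  apply h.zpow_ne_β m
  field_simp at h0
  linear_combination -h0

lemma zpow_ne_one (h : QGeneric q α β z) {m : ℤ} (hm : m ≠ 0) : q ^ m ≠ 1 := by
  rcases lt_or_gt_of_ne hm with hm | hm
  · obtain ⟨k, rfl⟩ : ∃ k : ℕ, m = -((k + 1 : ℕ) : ℤ) := ⟨(-m - 1).toNat, by lia⟩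
    rw [zpow_neg, zpow_natCast]
    exact fun h0 => h.pow_ne k (inv_eq_one.mp h0)
  · obtain ⟨k, rfl⟩ : ∃ k : ℕ, m = ((k + 1 : ℕ) : ℤ) := ⟨(m - 1).toNat, by lia⟩
    rw [zpow_natCast]
    exact h.pow_ne k

lemma symm (h : QGeneric q α β z) : QGeneric q β α z where
  q_ne := h.q_ne
  α_ne := h.β_ne
  β_ne := h.α_ne
  z_ne := h.z_ne
  pow_ne := h.pow_ne
  zpow_ne_α := h.zpow_ne_β
  zpow_mul_β m h0 := by
    apply h.zpow_ne_α (-m)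
    rw [zpow_neg]
    exact inv_eq_of_mul_eq_one_right h0
  zpow_ne_z := h.zpow_ne_z
  zpow_mul_α_ne_z := h.zpow_mul_β_ne_z
  zpow_mul_β_ne_z := h.zpow_mul_α_ne_z

end QGeneric

lemma gaussDiag_succ (h : QGeneric q α β z) {n s : ℕ} (hs : s < n) :
    gaussDiag q α β z n (s + 1) * (1 - q ^ (s + 1)) * (1 - q ^ ((n : ℤ) - s)) =
      gaussDiag q α β z n s * (α * β / z - q ^ s) * (1 - q ^ ((n : ℤ) - s - 1) / z) := by
  obtain ⟨d, rfl⟩ : ∃ d, n = s + d + 1 := ⟨n - s - 1, by lia⟩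
  have e1 : s + d + 1 - (s + 1) = d := by lia
  have e2 : s + d + 1 - s = d + 1 := by lia
  have e3 : ((s + d + 1 : ℕ) : ℤ) - s = (d + 1 : ℕ) := by lia
  have e4 : ((d + 1 : ℕ) : ℤ) - 1 = d := by lia
  have hα := h.α_ne
  have hβ := h.β_ne
  have hz := h.z_ne
  have h1 := qPoch_self_ne_zero h.pow_ne s
  have h2 := qPoch_ne_zero (a := 1 / z) (fun k => mod_cast h.one_sub_inv_z_ne k) d
  have h3 : 1 - 1 / z * q ^ d ≠ 0 := mod_cast h.one_sub_inv_z_ne d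
  have h4 : 1 - q ^ s * q ≠ 0 := by
    rw [← pow_succ]; exact sub_ne_zero.mpr (h.pow_ne s).symm
  unfold gaussDiag
  rw [e1, e2, e3, e4, qPoch_succ, qPoch_succ, qPoch_succ, qPoch_succ, zpow_natCast, zpow_natCast,
    pow_succ' q s, pow_succ' q d, pow_succ (α * β / z)]
  generalize qPoch q (z / (α * β)) s = p1 at *
  generalize qPoch q q d = p2 at *
  generalize qPoch q q s = p3 at *
  generalize qPoch q (1 / z) d = p4 at *
  have h5 : z - q ^ d ≠ 0 := by
    intro h0; apply h3; field_simp; rw [h0]; simp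
  field_simp

/-- Summation by parts against the first-order recurrence of `gaussDiag`. -/
lemma sum_gaussDiag_telescope (h : QGeneric q α β z) (n : ℕ) (f : ℕ → F) (hf : f (n + 1) = 0) :
    ∑ s ∈ range (n + 1),
      (gaussDiag q α β z n s * (α * β / z - q ^ s) * (1 - q ^ ((n : ℤ) - s - 1) / z) * f (s + 1) -
        gaussDiag q α β z n s * (1 - q ^ s) * (1 - q ^ ((n : ℤ) - s + 1)) * f s) = 0 := by
  rw [sum_sub_distrib, sum_range_succ, sum_range_succ', hf, sub_eq_zero]
  simp only [pow_zero, sub_self, mul_zero, zero_mul, add_zero]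
  refine sum_congr rfl fun s hs => ?_
  rw [← gaussDiag_succ h (mem_range.mp hs)]
  push_cast
  ring_nf

lemma gaussEntry_contiguous (h : QGeneric q α β z) {n : ℕ} {i : ℤ} (hi : i ≤ n) (m : ℤ) :
    (q ^ i - α * q) * (q ^ i - q ^ n / β) / q ^ i * gaussEntry q α β z n (i - 1) m +
      (q * α / β * (q ^ m - q ^ n / q ^ i) + q * z / β * (q ^ n / q ^ m - q ^ i)) *
        gaussEntry q α β z n i m =
      q * z / β * (1 - q * q ^ m) * (q ^ n / q ^ m - 1) * gaussEntry q α β z n i (m + 1) := by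
  have hq := h.q_ne
  have hα := h.α_ne
  have hβ := h.β_ne
  have hz := h.z_ne
  have key := sum_gaussDiag_telescope h n
    (fun s => qBinomCoeff q (β / z) (i - s) * qBinomCoeff q (α / z) (m + 1 - s))
    (by rw [qBinomCoeff_of_neg (by push_cast; lia), zero_mul])
  rw [← sub_eq_zero, ← mul_zero (-(q * z / β)), ← key]
  unfold gaussEntry
  simp only [mul_sum, ← sum_sub_distrib, ← sum_add_distrib]
  refine sum_congr rfl fun s _ => ?_
  have e1 : i - 1 - (s : ℤ) = i - s - 1 := by ring
  have e2 : m - (s : ℤ) = m + 1 - s - 1 := by ring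
  have e3 : i - ((s + 1 : ℕ) : ℤ) = i - s - 1 := by push_cast; ring
  have e4 : m + 1 - ((s + 1 : ℕ) : ℤ) = m + 1 - s - 1 := by push_cast; ring
  have hu := h.one_sub_β_div_z_ne (i - s - 1)
  have hv := h.one_sub_α_div_z_ne (m + 1 - s - 1)
  rw [e1, e2, e3, e4, qBinomCoeff_sub_one h.pow_ne h.one_sub_β_div_z_ne (i - s),
    qBinomCoeff_sub_one h.pow_ne h.one_sub_α_div_z_ne (m + 1 - s)]
  clear key
  generalize qBinomCoeff q (β / z) (i - s) = u
  generalize qBinomCoeff q (α / z) (m + 1 - s) = v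
  generalize gaussDiag q α β z n s = g
  simp only [zpow_sub₀ hq, zpow_add₀ hq, zpow_one, zpow_natCast] at *
  have hX : q ^ i ≠ 0 := zpow_ne_zero _ hq
  have hY : q ^ m ≠ 0 := zpow_ne_zero _ hq
  have ht : q ^ s ≠ 0 := pow_ne_zero _ hq
  generalize q ^ i = X at *
  generalize q ^ m = Y at *
  generalize q ^ s = t at *
  generalize q ^ n = N at *
  have hu' : z * t * q - β * X ≠ 0 := by
    intro h0; apply hu; field_simp; linear_combination h0
  have hv' : z * t - α * Y ≠ 0 := by
    intro h0; apply hv; field_simp; linear_combination h0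
  have hu2 : 1 - β / z * (X / t / q) = (z * t * q - β * X) / (z * t * q) := by field_simp
  have hv2 : 1 - α / z * (Y * q / t / q) = (z * t - α * Y) / (z * t) := by field_simp
  rw [hu2, hv2]
  generalize hP : z * t * q - β * X = P at *
  generalize hQ : z * t - α * Y = Q at *
  field_simp
  rw [← hP, ← hQ]
  ring

lemma gaussEntry_swap (n : ℕ) (i m : ℤ) : gaussEntry q α β z n i m = gaussEntry q β α z n m i := by
  unfold gaussEntry gaussDiag
  rw [mul_comm α β]
  exact sum_congr rfl fun s _ => mul_right_comm _ _ _

/-- The subdiagonal of `hamiltonian`, as a function of the row index. -/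
noncomputable def hamLower (q α β : F) (n : ℕ) (k : ℤ) : F :=
  (q ^ k - α * q) * (q ^ k - q ^ n / β) / q ^ k

/-- The diagonal of `hamiltonian`. -/
noncomputable def hamDiag (q α β z w : F) (n : ℕ) (k : ℤ) : F :=
  -(q / β) * ((z * w / β + α) * q ^ n / q ^ k + (z + w) * q ^ k)

/-- The superdiagonal of `hamiltonian`. -/
noncomputable def hamUpper (q β z w : F) (n : ℕ) (k : ℤ) : F :=
  q * z * w / β ^ 2 * (1 - q * q ^ k) * (q ^ n / q ^ k - 1)

/-- Entries of a tridiagonal matrix, symmetric in `z` and `w`, that commutes with `transport`. -/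
noncomputable def hamEntry (q α β z w : F) (n : ℕ) (i j : ℤ) : F :=
  if j = i + 1 then hamUpper q β z w n i
  else if j = i then hamDiag q α β z w n i
  else if j = i - 1 then hamLower q α β n i
  else 0

/-- The tridiagonal matrix with entries `hamEntry`. -/
noncomputable def hamiltonian (q α β z w : F) (n : ℕ) : Matrix (Fin (n + 1)) (Fin (n + 1)) F :=
  .of fun i j => hamEntry q α β z w n (i : ℕ) (j : ℕ)

/-- The product of `RHG` at `z` with the diagonal matrix `w ^ k`, in a rescaled basis. -/
noncomputable def transport (q α β z w : F) (n : ℕ) : Matrix (Fin (n + 1)) (Fin (n + 1)) F :=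
  .of fun i j => gaussEntry q α β z n (i : ℕ) ((n : ℤ) - (j : ℕ)) * (w / β) ^ (j : ℕ)

lemma hamiltonian_swap (n : ℕ) : hamiltonian q α β z w n = hamiltonian q α β w z n := by
  ext i j
  simp only [hamiltonian, hamEntry, hamUpper, hamDiag, Matrix.of_apply, mul_comm z w, add_comm z w,
    mul_assoc]

lemma sum_range_eq_of_support {n : ℕ} {i : ℤ} (h0 : 0 ≤ i) (hn : i ≤ n) (g : ℤ → F)
    (hg : ∀ k, k ≠ i - 1 → k ≠ i → k ≠ i + 1 → g k = 0) (hl : g (-1) = 0) (hr : g (n + 1) = 0) :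
    ∑ k ∈ range (n + 1), g k = g (i - 1) + g i + g (i + 1) := by
  have e1 : ∑ k ∈ range (n + 1), g k = ∑ k ∈ Icc (-1 : ℤ) (n + 1), g k := by
    rw [← sum_image (f := g) (g := fun k : ℕ => (k : ℤ)) (by intro a _ b _ hab; simpa using hab)]
    refine sum_subset ?_ ?_
    · intro k hk
      simp only [mem_image, mem_range, mem_Icc] at *
      lia
    · intro k hk hk'
      simp only [mem_image, mem_range, mem_Icc, not_exists, not_and] at *
      have h1 := hk' k.toNat
      rcases (by lia : k = -1 ∨ k = n + 1) with rfl | rfl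
      · exact hl
      · exact hr
  have e2 : g (i - 1) + g i + g (i + 1) = ∑ k ∈ {i - 1, i, i + 1}, g k := by
    rw [sum_insert (by simp; lia), sum_insert (by simp), sum_singleton, add_assoc]
  rw [e1, e2]
  refine (sum_subset ?_ ?_).symm
  · intro k hk
    simp only [mem_insert, mem_singleton, mem_Icc] at *
    lia
  · intro k _ hk
    simp only [mem_insert, mem_singleton, not_or] at hk
    exact hg k hk.1 hk.2.1 hk.2.2

lemma gaussEntry_of_left_neg {n : ℕ} {i m : ℤ} (hi : i < 0) : gaussEntry q α β z n i m = 0 :=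
  sum_eq_zero fun s _ => by rw [qBinomCoeff_of_neg (by lia)]; simp

lemma gaussEntry_of_right_neg {n : ℕ} {i m : ℤ} (hm : m < 0) : gaussEntry q α β z n i m = 0 :=
  sum_eq_zero fun s _ => by rw [qBinomCoeff_of_neg (m := m - s) (by lia)]; simp

lemma transport_hamiltonian_entry (h : QGeneric q α β z) (hw : w ≠ 0) {n : ℕ} {i j : ℤ}
    (hi : i ≤ n) (hj : 0 ≤ j) :
    let S : ℤ → ℤ → F := fun i j => gaussEntry q α β z n i (n - j)
    S i (j - 1) * (w / β) ^ (j - 1) * hamUpper q β z w n (j - 1) +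
        S i j * (w / β) ^ j * hamDiag q α β z w n j +
        S i (j + 1) * (w / β) ^ (j + 1) * hamLower q α β n (j + 1) =
      hamLower q α β n i * (S (i - 1) j * (w / β) ^ j) +
        hamDiag q α β z w n i * (S i j * (w / β) ^ j) +
        hamUpper q β z w n i * (S (i + 1) j * (w / β) ^ j) := by
  intro S
  have hq := h.q_ne
  have hα := h.α_ne
  have hβ := h.β_ne
  have hω : w / β ≠ 0 := div_ne_zero hw hβ
  have r1 := gaussEntry_contiguous h hi (n - j)
  have r2 := gaussEntry_contiguous h.symm (n := n) (i := n - j) (by lia) i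
  simp only [← gaussEntry_swap (α := α)] at r2
  have e1 : (n : ℤ) - (j - 1) = n - j + 1 := by ring
  have e2 : (n : ℤ) - (j + 1) = n - j - 1 := by ring
  simp only [S, e1, e2, hamUpper, hamDiag, hamLower]
  generalize gaussEntry q α β z n i (n - j - 1) = s1 at *
  generalize gaussEntry q α β z n i (n - j) = s2 at *
  generalize gaussEntry q α β z n i (n - j + 1) = s3 at *
  generalize gaussEntry q α β z n (i - 1) (n - j) = s4 at *
  generalize gaussEntry q α β z n (i + 1) (n - j) = s5 at *
  simp only [zpow_sub₀ hq, zpow_sub₀ hω, zpow_add₀ hq, zpow_add₀ hω, zpow_one, zpow_natCast] at *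
  generalize (w / β) ^ j = W at *
  have hX : q ^ i ≠ 0 := zpow_ne_zero _ hq
  have hY : q ^ j ≠ 0 := zpow_ne_zero _ hq
  have hN : q ^ n ≠ 0 := pow_ne_zero _ hq
  generalize q ^ i = X at *
  generalize q ^ j = Y at *
  generalize q ^ n = N at *
  clear h hi hj e1 e2 S hω
  have r1' : (X - α * q) * (X - N / β) / X * s4 +
      (q * α / β * (N / Y - N / X) + q * z / β * (Y - X)) * s2 =
      q * z / β * (1 - q * (N / Y)) * (Y - 1) * s3 := by
    convert r1 using 2 <;> field_simp
  have r2' : (Y * q - α * q) * (Y * q - N / β) / (Y * q) * s1 +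
      (q * (X - Y) + q * z / β * (N / X - N / Y)) * s2 =
      q * z / β * (1 - q * X) * (N / X - 1) * s5 := by
    have := congrArg (fun x => α / β * x) r2
    convert this using 1
    · field_simp
      ring
    · field_simp
  have hS3 : (1 - q * (Y / q)) * (N / (Y / q) - 1) = (1 - q * (N / Y)) * (Y - 1) := by
    field_simp; ring
  have g3 : s3 * (W / (w / β)) * (q * z * w / β ^ 2 * (1 - q * (Y / q)) * (N / (Y / q) - 1)) =
      W * (q * z / β * (1 - q * (N / Y)) * (Y - 1) * s3) := by
    rw [mul_assoc (q * z * w / β ^ 2), hS3]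
    field_simp
  rw [g3, ← r1']
  have g5 : q * z * w / β ^ 2 * (1 - q * X) * (N / X - 1) * (s5 * W) =
      W * (w / β) * (q * z / β * (1 - q * X) * (N / X - 1) * s5) := by
    field_simp
  rw [g5, ← r2']
  field_simp
  ring

lemma transport_commute_hamiltonian (h : QGeneric q α β z) (hw : w ≠ 0) (n : ℕ) :
    Commute (transport q α β z w n) (hamiltonian q α β z w n) := by
  have hq := h.q_ne
  ext i j
  have hi : ((i : ℕ) : ℤ) ≤ n := by have := i.isLt; lia
  have hj : ((j : ℕ) : ℤ) ≤ n := by have := j.isLt; lia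
  have hu1 : hamUpper q β z w n (-1) = 0 := by simp [hamUpper, hq]
  have hu2 : hamUpper q β z w n n = 0 := by simp [hamUpper, hq]
  simp only [Matrix.mul_apply, transport, hamiltonian, Matrix.of_apply]
  have e1 := sum_range_eq_of_support (F := F) (n := n) (i := (j : ℕ)) (by lia) hj
    (fun k => gaussEntry q α β z n (i : ℕ) (n - k) * (w / β) ^ k * hamEntry q α β z w n k (j : ℕ))
    (fun k h1 h2 h3 => by
      simp only [hamEntry]
      rw [if_neg (by lia), if_neg (by lia), if_neg (by lia), mul_zero])
    (by
      simp only [hamEntry]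
      rw [hu1, if_neg (by lia : ((j : ℕ) : ℤ) ≠ -1), if_neg (by lia : ((j : ℕ) : ℤ) ≠ -1 - 1),
        ite_self, mul_zero])
    (by rw [gaussEntry_of_right_neg (by lia)]; simp)
  have e2 := sum_range_eq_of_support (F := F) (n := n) (i := (i : ℕ)) (by lia) hi
    (fun k => hamEntry q α β z w n (i : ℕ) k * (gaussEntry q α β z n k (n - (j : ℕ)) *
      (w / β) ^ (j : ℕ)))
    (fun k h1 h2 h3 => by
      simp only [hamEntry]
      rw [if_neg (by lia), if_neg (by lia), if_neg (by lia), zero_mul])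
    (by rw [gaussEntry_of_left_neg (by lia)]; simp)
    (by
      by_cases hin : ((i : ℕ) : ℤ) = n
      · simp [hamEntry, hin, hu2]
      · simp only [hamEntry]
        rw [if_neg (by lia), if_neg (by lia), if_neg (by lia), zero_mul])
  have key := transport_hamiltonian_entry h hw (n := n) hi (Int.natCast_nonneg (j : ℕ))
  rw [Fin.sum_univ_eq_sum_range (fun k => gaussEntry q α β z n (i : ℕ) (n - (k : ℕ)) *
    (w / β) ^ k * hamEntry q α β z w n (k : ℕ) (j : ℕ)),
    Fin.sum_univ_eq_sum_range (fun k => hamEntry q α β z w n (i : ℕ) (k : ℕ) *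
    (gaussEntry q α β z n (k : ℕ) (n - (j : ℕ)) * (w / β) ^ (j : ℕ)))]
  simp only [zpow_natCast] at e1
  rw [e1, e2]
  simp only [hamEntry]
  simpa [show ∀ k : ℤ, k ≠ k + 1 + 1 by lia, show ∀ k : ℤ, k - 1 ≠ k + 1 by lia] using key

lemma hamLower_ne_zero (h : QGeneric q α β z) (n : ℕ) (k : ℤ) : hamLower q α β n k ≠ 0 := by
  have hq := h.q_ne
  have hβ := h.β_ne
  refine div_ne_zero (mul_ne_zero ?_ ?_) (zpow_ne_zero _ hq)
  · intro h0
    apply h.zpow_ne_α (k - 1)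
    rw [zpow_sub_one₀ hq, sub_eq_zero.mp h0]
    field_simp
  · intro h0
    apply h.zpow_ne_β (n - k)
    have hk := zpow_ne_zero k hq
    rw [zpow_sub₀ hq, zpow_natCast, sub_eq_zero.mp h0]
    field_simp

/-- Transport matrices with the roles of `z` and `w` exchanged commute. -/
lemma transport_commute (h : QGeneric q α β z) (h' : QGeneric q α β w) (n : ℕ) :
    Commute (transport q α β z w n) (transport q α β w z n) := by
  refine Matrix.commute_of_cyclic _ (Matrix.exists_aeval_mulVec_of_hessenberg _ ?_ ?_)
    (transport_commute_hamiltonian h h'.z_ne n)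
    (hamiltonian_swap (z := z) n ▸ transport_commute_hamiltonian h' h.z_ne n)
  · intro i j hij
    simp only [hamiltonian, hamEntry, Matrix.of_apply]
    rw [if_neg (by lia), if_neg (by lia), if_neg (by lia)]
  · intro i j hij
    simp only [hamiltonian, hamEntry, Matrix.of_apply]
    rw [if_neg (by lia), if_neg (by lia), if_pos (by lia)]
    exact hamLower_ne_zero h n _

lemma RHG_term (h : QGeneric q α β z) {n m i s : ℕ} (hm : m ≤ n) (hsi : s ≤ i)
    (hsm : s ≤ m) :
    qPoch q q n * qPoch q (α / z) m * qPoch q (β / z) i / (qPoch q q i * qPoch q (1 / z) n) *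
      (qPoch q (q ^ (-(i : ℤ))) s * qPoch q (q ^ (-(m : ℤ))) s *
          qPoch q (z / (α * β)) s * qPoch q (q ^ (1 - (n : ℤ)) * z) s * q ^ s /
        (qPoch q q s * qPoch q (q ^ (-(n : ℤ))) s *
          qPoch q (q ^ (1 - (i : ℤ)) * z / β) s * qPoch q (q ^ (-(m : ℤ) + 1) * z / α) s)) =
    qPoch q q m * (gaussDiag q α β z n s * qBinomCoeff q (β / z) (i - s) *
      qBinomCoeff q (α / z) (m - s)) := by
  have hq := h.q_ne
  have hα := h.α_ne
  have hβ := h.β_ne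
  have hz := h.z_ne
  induction s with
  | zero =>
    have h1 := qPoch_self_ne_zero h.pow_ne m
    simp only [gaussDiag, qPoch_zero, Nat.cast_zero, sub_zero, qBinomCoeff_natCast, pow_zero,
      Nat.sub_zero]
    field_simp
  | succ s ih =>
    have ih := ih (by lia) (by lia)
    have hd := gaussDiag_succ h (n := n) (s := s) (by lia)
    have c1 := sub_ne_zero.mpr (h.pow_ne s).symm
    have c2 := sub_ne_zero.mpr (h.zpow_ne_one (m := (n : ℤ) - s) (by lia)).symm
    have c3 := h.one_sub_β_div_z_ne (i - s - 1)
    have c4 := h.one_sub_α_div_z_ne (m - s - 1)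
    have e1 : (i : ℤ) - ((s + 1 : ℕ) : ℤ) = i - s - 1 := by push_cast; ring
    have e2 : (m : ℤ) - ((s + 1 : ℕ) : ℤ) = m - s - 1 := by push_cast; ring
    rw [mul_assoc, ← eq_div_iff (mul_ne_zero c1 c2)] at hd
    rw [e1, e2, qBinomCoeff_sub_one h.pow_ne h.one_sub_β_div_z_ne (i - s),
      qBinomCoeff_sub_one h.pow_ne h.one_sub_α_div_z_ne (m - s), hd]
    simp only [qPoch_succ]
    generalize qBinomCoeff q (β / z) (i - s) = u at *
    generalize qBinomCoeff q (α / z) (m - s) = v at *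
    generalize gaussDiag q α β z n s = g at *
    generalize qPoch q q m = M at *
    have split : ∀ P a1 a2 a3 a4 t x1 x2 x3 x4 b1 b2 b3 b4 y1 y2 y3 y4 : F,
        P * (a1 * x1 * (a2 * x2) * (a3 * x3) * (a4 * x4) * (t * q) /
          (b1 * y1 * (b2 * y2) * (b3 * y3) * (b4 * y4))) =
        P * (a1 * a2 * a3 * a4 * t / (b1 * b2 * b3 * b4)) *
          (x1 * x2 * x3 * x4 * q / (y1 * y2 * y3 * y4)) := by
      intro P
      intros
      rw [mul_assoc P, div_mul_div_comm]
      congr 2 <;> ring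
    rw [pow_succ q s] at c1 ⊢
    rw [split, ih]
    clear ih hd split
    simp only [zpow_sub₀ hq, zpow_add₀ hq, zpow_neg, zpow_one, zpow_natCast] at *
    have hX : q ^ i ≠ 0 := pow_ne_zero _ hq
    have hY : q ^ m ≠ 0 := pow_ne_zero _ hq
    have ht : q ^ s ≠ 0 := pow_ne_zero _ hq
    have hN : q ^ n ≠ 0 := pow_ne_zero _ hq
    generalize q ^ i = X at *
    generalize q ^ m = Y at *
    generalize q ^ s = t at *
    generalize q ^ n = N at *
    have d1 : 1 - q * t ≠ 0 := by rwa [mul_comm]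
    have f2 : 1 - N⁻¹ * t = -(t / N) * (1 - N / t) := by field_simp; ring
    have f3 : 1 - q / X * z / β * t = -(z * t * q / (β * X)) * (1 - β / z * (X / t / q)) := by
      field_simp; ring
    have f4 : 1 - Y⁻¹ * q * z / α * t = -(z * t * q / (α * Y)) * (1 - α / z * (Y / t / q)) := by
      field_simp; ring
    have f1 : 1 - t * q = 1 - q * t := by ring
    rw [f1, f2, f3, f4]
    generalize 1 - N / t = C2 at *
    generalize hC3 : 1 - β / z * (X / t / q) = C3 at *
    generalize hC4 : 1 - α / z * (Y / t / q) = C4 at *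
    generalize 1 - q * t = C1 at *
    field_simp
    ring

lemma RHG_eq_gaussEntry (h : QGeneric q α β z) {n i j : ℕ} (hi : i ≤ n) (hj : j ≤ n) :
    RHG q α β z n i j =
      β ^ (-(i : ℤ)) * (qPoch q (1 / β) (n - i) / qPoch q q (n - i)) /
        (qPoch q (1 / β) (n - j) / qPoch q q (n - j)) * gaussEntry q α β z n i (n - j) := by
  obtain ⟨m, rfl⟩ : ∃ m, n = j + m := ⟨n - j, by lia⟩
  have e0 : j + m - j = m := by lia
  have e1 : (j : ℤ) - ((j + m : ℕ) : ℤ) = -m := by push_cast; ring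
  have e2 : ((j + m : ℕ) : ℤ) - j = m := by push_cast; ring
  have hsub : gaussEntry q α β z (j + m) i m = ∑ s ∈ range (min i m + 1),
      gaussDiag q α β z (j + m) s * qBinomCoeff q (β / z) (i - s) *
        qBinomCoeff q (α / z) (m - s) := by
    refine (sum_subset (range_mono (by lia)) fun s _ hs => ?_).symm
    rcases (by simp at hs; lia : i < s ∨ m < s) with hs | hs
    · rw [qBinomCoeff_of_neg (by lia)]; simp
    · rw [qBinomCoeff_of_neg (m := m - s) (by lia)]; simp
  have key : ∀ c : F, ∀ T : ℕ → F,
      (∀ s ≤ min i m, c * T s = qPoch q q m * (gaussDiag q α β z (j + m) s *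
        qBinomCoeff q (β / z) (i - s) * qBinomCoeff q (α / z) (m - s))) →
      c * ∑ s ∈ range (min i m + 1), T s = qPoch q q m * gaussEntry q α β z (j + m) i m := by
    intro c T hT
    rw [hsub, mul_sum, mul_sum]
    exact sum_congr rfl fun s hs => hT s (by simp at hs; lia)
  have := key _ _ fun s hs =>
    RHG_term h (n := j + m) (m := m) (i := i) (s := s) (by lia) (by lia) (by lia)
  unfold RHG
  rw [e0, e1, e2]
  trans β ^ (-(i : ℤ)) * (qPoch q (1 / β) (j + m - i) / qPoch q q (j + m - i)) /
    qPoch q (1 / β) m * (qPoch q q m * gaussEntry q α β z (j + m) i m)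
  · rw [← this]
    ring
  · rw [div_div_eq_mul_div]
    ring

/-- The commutativity of the two connection matrices over any field with generic parameters. -/
theorem sum_RHG_mul_RHG_comm (h : QGeneric q α β z) (h' : QGeneric q α β w) {n i j : ℕ}
    (hi : i ≤ n) (hj : j ≤ n) :
    ∑ k ∈ range (n + 1), RHG q α β z n i k * w ^ k * RHG q α β w n k j * z ^ j =
      ∑ k ∈ range (n + 1), RHG q α β w n i k * z ^ k * RHG q α β z n k j * w ^ j := by
  have main : ∀ z w : F, QGeneric q α β z → QGeneric q α β w →
      ∑ k ∈ range (n + 1), RHG q α β z n i k * w ^ k * RHG q α β w n k j * z ^ j =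
        β ^ j * (β ^ (-(i : ℤ)) * (qPoch q (1 / β) (n - i) / qPoch q q (n - i)) /
          (qPoch q (1 / β) (n - j) / qPoch q q (n - j))) *
        (transport q α β z w n * transport q α β w z n) ⟨i, by lia⟩ ⟨j, by lia⟩ := by
    intro z w h h'
    have hβ := h.β_ne
    simp only [Matrix.mul_apply, transport, Matrix.of_apply]
    rw [Fin.sum_univ_eq_sum_range (fun k => gaussEntry q α β z n i (n - (k : ℕ)) *
      (w / β) ^ k * (gaussEntry q α β w n (k : ℕ) (n - j) * (z / β) ^ j)), mul_sum]
    refine sum_congr rfl fun k hk => ?_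
    have hk : k ≤ n := by simp at hk; lia
    rw [RHG_eq_gaussEntry h hi hk, RHG_eq_gaussEntry h' hk hj, zpow_neg, zpow_neg, zpow_natCast,
      zpow_natCast, div_pow, div_pow]
    have h1 : qPoch q (1 / β) (n - k) / qPoch q q (n - k) ≠ 0 :=
      div_ne_zero (qPoch_ne_zero (fun k => mod_cast h.one_sub_inv_β_ne k) _)
        (qPoch_self_ne_zero h.pow_ne _)
    generalize qPoch q (1 / β) (n - k) / qPoch q q (n - k) = c at *
    generalize qPoch q (1 / β) (n - i) / qPoch q q (n - i) = c1 at *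
    generalize qPoch q (1 / β) (n - j) / qPoch q q (n - j) = c2 at *
    field_simp
  rw [main z w h h', main w z h' h, (transport_commute h h' n).eq]

end QSeries

/-- Evaluation at a point with `X 0 = 1` separates polynomials up to powers of `X 0`. -/
lemma zpow_X_zero_mul_ne {P Q : MvPolynomial (Fin 5) ℚ} (f : Fin 5 → ℚ) (hf : f 0 = 1)
    (hPQ : MvPolynomial.eval f P ≠ MvPolynomial.eval f Q) (m : ℤ) :
    algebraMap (MvPolynomial (Fin 5) ℚ) F6 (MvPolynomial.X 0) ^ m * algebraMap _ F6 P ≠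
      algebraMap _ F6 Q := by
  have hX : algebraMap (MvPolynomial (Fin 5) ℚ) F6 (MvPolynomial.X 0) ≠ 0 := by
    simp
  have hinj := FaithfulSMul.algebraMap_injective (MvPolynomial (Fin 5) ℚ) F6
  intro h0
  apply hPQ
  obtain ⟨k, rfl | rfl⟩ := m.eq_nat_or_neg
  · rw [zpow_natCast, ← map_pow, ← map_mul] at h0
    simpa [hf] using congrArg (MvPolynomial.eval f) (hinj h0)
  · rw [zpow_neg, zpow_natCast, inv_mul_eq_iff_eq_mul₀ (pow_ne_zero _ hX), ← map_pow,
      ← map_mul] at h0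
    simpa [hf] using congrArg (MvPolynomial.eval f) (hinj h0)

lemma qGeneric_X {c : Fin 5} (hc : 3 ≤ c) :
    QGeneric (algebraMap (MvPolynomial (Fin 5) ℚ) F6 (MvPolynomial.X 0))
      (algebraMap (MvPolynomial (Fin 5) ℚ) F6 (MvPolynomial.X 1))
      (algebraMap (MvPolynomial (Fin 5) ℚ) F6 (MvPolynomial.X 2))
      (algebraMap (MvPolynomial (Fin 5) ℚ) F6 (MvPolynomial.X c)) := by
  have hc0 : c ≠ 0 := by rintro rfl; simp at hc
  have hc1 : c ≠ 1 := by rintro rfl; simp at hc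
  have hc2 : c ≠ 2 := by rintro rfl; simp at hc
  let f : Fin 5 → ℚ := fun i => if i = 0 then 1 else 2
  let g : Fin 5 → ℚ := fun i => if i = c then 2 else 1
  refine ⟨by simp, by simp, by simp, by simp, fun k hk => ?_, fun m => ?_, fun m => ?_,
    fun m => ?_, fun m => ?_, fun m => ?_⟩
  · have hinj := FaithfulSMul.algebraMap_injective (MvPolynomial (Fin 5) ℚ) F6
    rw [← map_pow, ← map_one (algebraMap (MvPolynomial (Fin 5) ℚ) F6)] at hk
    simpa using congrArg (MvPolynomial.eval (0 : Fin 5 → ℚ)) (hinj hk)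
  · simpa using zpow_X_zero_mul_ne (P := 1) (Q := MvPolynomial.X 1) f (by simp [f]) (by simp [f]) m
  · simpa using zpow_X_zero_mul_ne (P := MvPolynomial.X 2) (Q := 1) f (by simp [f]) (by simp [f]) m
  · simpa using zpow_X_zero_mul_ne (P := 1) (Q := MvPolynomial.X c) f (by simp [f])
      (by simp [f, hc0]) m
  · exact zpow_X_zero_mul_ne g (by simp [g, hc0.symm]) (by simp [g, hc1.symm]) m
  · exact zpow_X_zero_mul_ne g (by simp [g, hc0.symm]) (by simp [g, hc2.symm]) m

/-- Theorem D.6: the commutativity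
`Σ_k 𝖱ⁿ_{ik}(α,β|z) w^k 𝖱ⁿ_{kj}(α,β|w) z^j = Σ_k 𝖱ⁿ_{ik}(α,β|w) z^k 𝖱ⁿ_{kj}(α,β|z) w^j`. -/
theorem statement6
    (q α β z w : F6)
    (hq : q = algebraMap (MvPolynomial (Fin 5) ℚ) F6 (MvPolynomial.X 0))
    (hα : α = algebraMap (MvPolynomial (Fin 5) ℚ) F6 (MvPolynomial.X 1))
    (hβ : β = algebraMap (MvPolynomial (Fin 5) ℚ) F6 (MvPolynomial.X 2))
    (hz : z = algebraMap (MvPolynomial (Fin 5) ℚ) F6 (MvPolynomial.X 3))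
    (hw : w = algebraMap (MvPolynomial (Fin 5) ℚ) F6 (MvPolynomial.X 4))
    (n : ℕ) :
    ∀ i j : ℕ, i ≤ n → j ≤ n →
      ∑ k ∈ Finset.range (n + 1),
          RHG q α β z n i k * w ^ k * RHG q α β w n k j * z ^ j =
        ∑ k ∈ Finset.range (n + 1),
          RHG q α β w n i k * z ^ k * RHG q α β z n k j * w ^ j := by
  subst hq hα hβ hz hw
  exact fun i j hi hj =>
    sum_RHG_mul_RHG_comm (qGeneric_X (by decide)) (qGeneric_X (by decide)) hi hj
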